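/- Let m ≥ 1, p ∈ [0,1] with p·m an integer, and φ ∈ [0,1]. Then the approvalwise distance between av(p,φ) and the p-ID vector equals 2·m·p·(1−p)·φ, and the approvalwise distance between av(p,φ) and the p-IC vector equals 2·m·p·(1−p)·(1−φ). In particular, av(p,φ) lies at exactly a φ fraction of the distance 2·m·p·(1−p) between the p-ID and the p-IC vector. -/

import Mathlib

/-- The vector av(p,φ) ∈ ℝ^m: its first p·m coordinates (here k = p·m) equal
(1−φ) + φ·p and its remaining (1−p)·m coordinates equal φ·p. -/
def avVec (m k : ℕ) (p φ : ℝ) : Fin m → ℝ :=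
  fun i => if (i : ℕ) < k then (1 - φ) + φ * p else φ * p

/-- The approvalwise distance: the ℓ1 distance between two vectors in ℝ^m. -/
def dapp {m : ℕ} (x y : Fin m → ℝ) : ℝ := ∑ i, |x i - y i|

theorem Fin.sum_ite_val_lt {m k : ℕ} (hkm : k ≤ m) (a b : ℝ) :
    ∑ i : Fin m, (if (i : ℕ) < k then a else b) = k * a + (m - k) * b := by
  obtain ⟨n, rfl⟩ := Nat.exists_eq_add_of_le hkm
  simp [Fin.sum_univ_add]

/-- The approvalwise distance between two vectors av(p,φ) and av(p,ψ) with the same p. -/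
theorem dapp_avVec_avVec {m k : ℕ} {p : ℝ} (hp : p ∈ Set.Icc (0 : ℝ) 1)
    (hk : (k : ℝ) = p * m) (φ ψ : ℝ) :
    dapp (avVec m k p φ) (avVec m k p ψ) = 2 * m * p * (1 - p) * |φ - ψ| := by
  obtain ⟨hp0, hp1⟩ := hp
  have hkm : k ≤ m := by
    have h : (k : ℝ) ≤ m := hk ▸ mul_le_of_le_one_left m.cast_nonneg hp1
    exact_mod_cast h
  have hcoord (i : Fin m) : |avVec m k p φ i - avVec m k p ψ i| =
      if (i : ℕ) < k then (1 - p) * |φ - ψ| else p * |φ - ψ| := by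
    unfold avVec
    split_ifs
    · rw [show 1 - φ + φ * p - (1 - ψ + ψ * p) = -((1 - p) * (φ - ψ)) by ring, abs_neg, abs_mul,
        abs_of_nonneg (sub_nonneg.2 hp1)]
    · rw [← sub_mul, abs_mul, abs_of_nonneg hp0, mul_comm]
  simp only [dapp, hcoord]
  rw [Fin.sum_ite_val_lt hkm, hk]
  ring

/-- For m ≥ 1, p ∈ [0,1] with p·m an integer, and φ ∈ [0,1], the
approvalwise distance from av(p,φ) to the p-ID vector av(p,0) equals 2·m·p·(1−p)·φ,
and to the p-IC vector av(p,1) equals 2·m·p·(1−p)·(1−φ); so av(p,φ) lies at exactly a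
φ fraction of the distance 2·m·p·(1−p) between the p-ID and the p-IC vector. -/
theorem dapp_avVec_pID_pIC (m k : ℕ) (hm : 1 ≤ m) (p φ : ℝ)
    (hp : p ∈ Set.Icc (0 : ℝ) 1) (hφ : φ ∈ Set.Icc (0 : ℝ) 1)
    (hk : (k : ℝ) = p * m) :
    dapp (avVec m k p φ) (avVec m k p 0) = 2 * m * p * (1 - p) * φ ∧
      dapp (avVec m k p φ) (avVec m k p 1) = 2 * m * p * (1 - p) * (1 - φ) := by
  rw [dapp_avVec_avVec hp hk, dapp_avVec_avVec hp hk, sub_zero, abs_of_nonneg hφ.1,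
    abs_sub_comm, abs_of_nonneg (sub_nonneg.2 hφ.2)]
  exact ⟨rfl, rfl⟩
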